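/- Fix reals α, β with 0 ≤ α < 1 and β > 2, and suppose D(a) is bounded. If x ∈ Σ does not contain arbitrarily long initial subwords of b, i.e., the set {n ∈ ℕ : (x_j,…,x_{j+n−1}) = (b_1,…,b_n) for some j ∈ ℕ} is bounded, then there exists a closed σ-invariant subset Σ′ ⊆ Σ with x ∈ Σ′ whose language has specification. -/

import Mathlib

noncomputable section

namespace IntermediateBeta

/-- The intermediate beta transformation `x ↦ βx + α mod 1`. -/
def F (α β : ℝ) (x : ℝ) : ℝ := Int.fract (β * x + α)

/-- The digit sequence of a point: `Om α β x n` is the index `i` with `F^[n] x ∈ J_i`.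
For `y ∈ [0,1)` we have `y ∈ J_i ↔ ⌊β y + α⌋ = i`. -/
def Om (α β : ℝ) (x : ℝ) : ℕ → ℕ := fun n => (⌊β * ((F α β)^[n] x) + α⌋).toNat

/-- `ℓ = ⌈α + β⌉ - 1`. -/
def ell (α β : ℝ) : ℕ := ⌈α + β⌉₊ - 1

/-- The subshift `Σ`: closure (in the product topology) of the set of digit sequences
of points of `[0,1)`. -/
def Sig (α β : ℝ) : Set (ℕ → ℕ) := closure (Om α β '' Set.Ico (0 : ℝ) 1)

/-- The shift map. -/
def shift (x : ℕ → ℕ) : ℕ → ℕ := fun n => x (n + 1)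

/-- Lexicographic order on one-sided sequences. -/
def lexLe (x y : ℕ → ℕ) : Prop := x = y ∨ ∃ k, (∀ i < k, x i = y i) ∧ x k < y k

/-- The language of a subset `S` of the full shift: the finite words occurring as
initial segments of elements of `S`. -/
def langOf (S : Set (ℕ → ℕ)) (w : List ℕ) : Prop :=
  ∃ x ∈ S, ∀ i : Fin w.length, x i = w.get i

/-- Membership in the language `𝓛` of the subshift `Σ`. -/
def inLang (α β : ℝ) (w : List ℕ) : Prop := langOf (Sig α β) w

/-- The tail segment of `w` of length `k` agrees with the initial segment of `s`
of length `k`. -/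
def tailAgrees (s : ℕ → ℕ) (w : List ℕ) (k : ℕ) : Prop :=
  k ≤ w.length ∧ ∀ i < k, w.getD (w.length - k + i) 0 = s i

/-- `kmax s w` is the length of the longest tail segment of `w` agreeing with an
initial segment of `s` (`k₁(w)` when `s = a`, `k₂(w)` when `s = b`). -/
def kmax (s : ℕ → ℕ) (w : List ℕ) : ℕ := sSup {k | tailAgrees s w k}

/-- `D a b` is the set of lengths `n` such that the initial segment of `b` of
length `n` occurs somewhere in `a`.  Thus `D a b` is the set `𝖣(a)` of the paper
and `D b a` is `𝖣(b)`. -/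
def D (a b : ℕ → ℕ) : Set ℕ := {n | ∃ j, ∀ i < n, b i = a (j + i)}

/-- Gluing of the words `w 0, v 0, w 1, v 1, …, v (n-1), w n`. -/
def glue {n : ℕ} (w : Fin (n + 1) → List ℕ) (v : Fin n → List ℕ) : List ℕ :=
  (List.ofFn fun i : Fin n => w i.castSucc ++ v i).flatten ++ w (Fin.last n)

/-- A collection `G` of words inside the language `lang` has specification: there
is `τ ∈ ℕ` such that any finite list of words of `G` can be glued, with gluing
words from `lang` of length `τ`, into a word of `lang`. -/
def HasSpec (lang G : List ℕ → Prop) : Prop :=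
  ∃ τ : ℕ, 1 ≤ τ ∧ ∀ n : ℕ, ∀ w : Fin (n + 1) → List ℕ, (∀ i, G (w i)) →
    ∃ v : Fin n → List ℕ, (∀ i, (v i).length = τ ∧ lang (v i)) ∧ lang (glue w v)

/-- The initial segment of a sequence, as a finite word. -/
def pre (s : ℕ → ℕ) (n : ℕ) : List ℕ := List.ofFn fun i : Fin n => s i

/-- Lexicographic order for finite words (of equal length). -/
def wordLe (u v : List ℕ) : Prop :=
  u = v ∨ ∃ k, (∀ i < k, u.getD i 0 = v.getD i 0) ∧ u.getD k 0 < v.getD k 0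

/-- Concatenation of a finite word with an infinite sequence. -/
def wcat (w : List ℕ) (x : ℕ → ℕ) : ℕ → ℕ := fun n =>
  if h : n < w.length then w.get ⟨n, h⟩ else x (n - w.length)

/-! ### Cylinder description of the closure -/

lemma exists_of_mem_closure {A : Set (ℕ → ℕ)} {y : ℕ → ℕ} (h : y ∈ closure A) (n : ℕ) :
    ∃ z ∈ A, ∀ i < n, z i = y i := by
  have ho : IsOpen (⋂ i ∈ Finset.range n, {z : ℕ → ℕ | z i = y i}) := by
    apply isOpen_biInter_finset
    intro i _
    have hc : Continuous (fun z : ℕ → ℕ => z i) := continuous_apply i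
    exact (isOpen_discrete ({y i} : Set ℕ)).preimage hc
  obtain ⟨z, hz1, hz2⟩ := mem_closure_iff.1 h _ ho (by simp)
  refine ⟨z, hz2, fun i hi => ?_⟩
  simp only [Set.mem_iInter, Finset.mem_range] at hz1
  exact hz1 i hi

lemma mem_closure_of_exists {A : Set (ℕ → ℕ)} {y : ℕ → ℕ}
    (h : ∀ n, ∃ z ∈ A, ∀ i < n, z i = y i) : y ∈ closure A := by
  rw [mem_closure_iff]
  intro o ho hy
  obtain ⟨I, u, hu, hsub⟩ := isOpen_pi_iff.1 ho y hy
  obtain ⟨z, hz, hzy⟩ := h (I.sup id + 1)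
  refine ⟨z, hsub ?_, hz⟩
  intro i hi
  have : i ≤ I.sup id := Finset.le_sup (f := id) hi
  rw [hzy i (by omega)]
  exact (hu i hi).2

/-! ### Inverse branches and admissible words -/

/-- Inverse branch of the map along a word. -/
def pull (α β : ℝ) : List ℕ → ℝ → ℝ
  | [], t => t
  | e :: w, t => (pull α β w t + e - α) / β

/-- All the points on the inverse branch lie in the unit interval. -/
def valid (α β : ℝ) : List ℕ → ℝ → Prop
  | [], t => 0 ≤ t ∧ t < 1
  | e :: w, t => (0 ≤ (pull α β w t + e - α) / β ∧ (pull α β w t + e - α) / β < 1) ∧ valid α β w t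

/-- A word is free if its cylinder is mapped onto the whole unit interval. -/
def free (α β : ℝ) (w : List ℕ) : Prop := ∀ t : ℝ, 0 ≤ t → t < 1 → valid α β w t

lemma pull_append (α β : ℝ) (w₁ w₂ : List ℕ) (t : ℝ) :
    pull α β (w₁ ++ w₂) t = pull α β w₁ (pull α β w₂ t) := by
  induction w₁ with
  | nil => rfl
  | cons e w ih => simp [pull, ih]

lemma valid_pull {α β : ℝ} {w : List ℕ} {t : ℝ} (h : valid α β w t) :
    0 ≤ pull α β w t ∧ pull α β w t < 1 := by
  cases w with
  | nil => exact h
  | cons e w => exact h.1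

lemma valid_append (α β : ℝ) (w₁ w₂ : List ℕ) (t : ℝ) :
    valid α β (w₁ ++ w₂) t ↔ valid α β w₁ (pull α β w₂ t) ∧ valid α β w₂ t := by
  induction w₁ with
  | nil =>
    simp only [List.nil_append, valid]
    exact ⟨fun h => ⟨valid_pull h, h⟩, fun h => h.2⟩
  | cons e w ih => simp [valid, pull_append, ih, and_assoc]

lemma free_append {α β : ℝ} {w₁ w₂ : List ℕ} (h₁ : free α β w₁) (h₂ : free α β w₂) :
    free α β (w₁ ++ w₂) := by
  intro t h0 h1
  have := h₂ t h0 h1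
  exact (valid_append _ _ _ _ _).2 ⟨h₁ _ (valid_pull this).1 (valid_pull this).2, this⟩

lemma free_suffix {α β : ℝ} {w₁ w₂ : List ℕ} (h : free α β (w₁ ++ w₂)) : free α β w₂ :=
  fun t h0 h1 => ((valid_append _ _ _ _ _).1 (h t h0 h1)).2

lemma free_nil (α β : ℝ) : free α β [] := fun _ h0 h1 => ⟨h0, h1⟩

lemma free_ones {α β : ℝ} (hα0 : 0 ≤ α) (hα1 : α < 1) (hβ : 2 < β) (n : ℕ) :
    free α β (List.replicate n 1) := by
  induction n with
  | zero => exact free_nil α β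
  | succ n ih =>
    intro t h0 h1
    have hv := ih t h0 h1
    have hp := valid_pull hv
    refine ⟨⟨?_, ?_⟩, hv⟩
    · apply div_nonneg _ (by linarith)
      push_cast; linarith [hp.1]
    · rw [div_lt_one (by linarith)]
      push_cast; linarith [hp.2]

lemma Om_zero (α β s : ℝ) : Om α β s 0 = (⌊β * s + α⌋).toNat := rfl

lemma Om_succ (α β s : ℝ) (n : ℕ) : Om α β s (n + 1) = Om α β (F α β s) n := by
  simp [Om, Function.iterate_succ_apply]

lemma Om_iter (α β s : ℝ) (i n : ℕ) : Om α β ((F α β)^[i] s) n = Om α β s (i + n) := by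
  simp only [Om]
  rw [← Function.iterate_add_apply, Nat.add_comm n i]

lemma F_mem (α β s : ℝ) : 0 ≤ F α β s ∧ F α β s < 1 := ⟨Int.fract_nonneg _, Int.fract_lt_one _⟩

lemma F_iter_mem (α β s : ℝ) (h0 : 0 ≤ s) (h1 : s < 1) (n : ℕ) :
    0 ≤ (F α β)^[n] s ∧ (F α β)^[n] s < 1 := by
  cases n with
  | zero => exact ⟨h0, h1⟩
  | succ n => rw [Function.iterate_succ_apply']; exact F_mem _ _ _

/-- The map in terms of the digit. -/
lemma F_digit {α β s : ℝ} (hα0 : 0 ≤ α) (hβ : 2 < β) (h0 : 0 ≤ s) :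
    F α β s = β * s + α - (Om α β s 0 : ℕ) := by
  have hn : 0 ≤ ⌊β * s + α⌋ := Int.floor_nonneg.2 (by nlinarith)
  have : ((⌊β * s + α⌋.toNat : ℕ) : ℝ) = (⌊β * s + α⌋ : ℝ) := by
    have := Int.toNat_of_nonneg hn
    exact_mod_cast congrArg (Int.cast : ℤ → ℝ) this
  rw [Om_zero, this, F]
  rfl

/-- Identification of the digit and the image. -/
lemma digit_of {α β s : ℝ} {e : ℕ} {r : ℝ} (h : β * s + α = r + e) (h0 : 0 ≤ r) (h1 : r < 1) :
    Om α β s 0 = e ∧ F α β s = r := by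
  have hf : ⌊β * s + α⌋ = (e : ℤ) := by
    rw [Int.floor_eq_iff, h]
    push_cast
    constructor <;> linarith
  refine ⟨by rw [Om_zero, hf]; simp, ?_⟩
  rw [F, Int.fract, hf, h]; simp

lemma Om_pull {α β : ℝ} (hβ : 2 < β) {w : List ℕ} {t : ℝ} (h : valid α β w t) :
    ∀ i (hi : i < w.length), Om α β (pull α β w t) i = w[i] := by
  induction w with
  | nil => intro i hi; simp at hi
  | cons e w ih =>
    have hp := valid_pull h.2
    have hd := digit_of (α := α) (β := β) (s := pull α β (e :: w) t) (e := e)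
      (r := pull α β w t) (by simp only [pull]; field_simp; ring) hp.1 hp.2
    intro i hi
    cases i with
    | zero => simpa using hd.1
    | succ i => rw [Om_succ, hd.2]; simpa using ih h.2 i (by simpa using hi)

/-! ### Growth of intervals -/

lemma growth {α β : ℝ} (hα0 : 0 ≤ α) (hα1 : α < 1) (hβ : 2 < β) (n : ℕ) :
    ∀ u v : ℝ, 0 ≤ u → v ≤ 1 → u < v → 1 < (β / 2) ^ n * (v - u) →
      ∃ w : List ℕ, w.length = n ∧
        ∀ t : ℝ, 0 ≤ t → t < 1 → valid α β w t ∧ u ≤ pull α β w t ∧ pull α β w t < v := by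
  have hb0 : 0 < β := by linarith
  -- adding a letter
  have key : ∀ (n e : ℕ) (u v u' v' : ℝ), 0 ≤ u → v ≤ 1 → 0 ≤ u' → v' ≤ 1 →
      β * u + α ≤ u' + e → v' + e ≤ β * v + α →
      (∃ w : List ℕ, w.length = n ∧
        ∀ t : ℝ, 0 ≤ t → t < 1 → valid α β w t ∧ u' ≤ pull α β w t ∧ pull α β w t < v') →
      ∃ w : List ℕ, w.length = n + 1 ∧
        ∀ t : ℝ, 0 ≤ t → t < 1 → valid α β w t ∧ u ≤ pull α β w t ∧ pull α β w t < v := by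
    rintro n e u v u' v' hu hv hu' hv' h1 h2 ⟨w, hw, hw'⟩
    refine ⟨e :: w, by simp [hw], fun t ht0 ht1 => ?_⟩
    obtain ⟨h3, h4, h5⟩ := hw' t ht0 ht1
    have h6 : u ≤ (pull α β w t + e - α) / β := by
      rw [le_div_iff₀ hb0]; linarith
    have h7 : (pull α β w t + e - α) / β < v := by
      rw [div_lt_iff₀ hb0]; linarith
    exact ⟨⟨⟨by linarith, by linarith⟩, h3⟩, h6, h7⟩
  induction n with
  | zero =>
    intro u v hu hv huv h
    simp at h
    linarith
  | succ n ih =>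
    intro u v hu hv huv h
    have hbu : 0 ≤ β * u + α := by positivity
    set e : ℕ := ⌊β * u + α⌋₊ with he
    have he1 : (e : ℝ) ≤ β * u + α := Nat.floor_le hbu
    have he2 : β * u + α < e + 1 := Nat.lt_floor_add_one _
    have hpos : 0 < (β / 2) ^ n := by positivity
    rw [pow_succ] at h
    have hbuv : β * u < β * v := by nlinarith
    by_cases c1 : β * v + α ≤ e + 1
    · apply key n e u v (β * u + α - e) (β * v + α - e) hu hv (by linarith) (by linarith)
        (by linarith) (by linarith)
      apply ih _ _ (by linarith) (by linarith) (by linarith)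
      have : (β / 2) ^ n * (β / 2 * (v - u)) ≤ (β / 2) ^ n * (β * v + α - e - (β * u + α - e)) := by
        apply mul_le_mul_of_nonneg_left _ hpos.le
        nlinarith
      linarith
    push Not at c1
    by_cases c2 : (e : ℝ) + 2 ≤ β * v + α
    · apply key n (e + 1) u v 0 1 hu hv le_rfl le_rfl (by push_cast; linarith)
        (by push_cast; linarith)
      exact ⟨List.replicate n 1, by simp, fun t h0 h1 =>
        have hf := free_ones hα0 hα1 hβ n t h0 h1
        ⟨hf, valid_pull hf⟩⟩
    push Not at c2
    by_cases c3 : β / 2 * (v - u) ≤ 1 - (β * u + α - e)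
    · apply key n e u v (β * u + α - e) 1 hu hv (by linarith) le_rfl (by linarith) (by linarith)
      apply ih _ _ (by linarith) le_rfl (by linarith)
      have := mul_le_mul_of_nonneg_left c3 hpos.le
      linarith
    · push Not at c3
      apply key n (e + 1) u v 0 (β * v + α - e - 1) hu hv le_rfl (by linarith)
        (by push_cast; linarith) (by push_cast; linarith)
      apply ih _ _ le_rfl (by linarith) (by linarith)
      have c4 : β / 2 * (v - u) ≤ β * v + α - e - 1 - 0 := by linarith
      have := mul_le_mul_of_nonneg_left c4 hpos.le
      linarith

/-! ### The left-continuous version of the map -/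

/-- Left-continuous version of `F`. -/
def G (α β : ℝ) (v : ℝ) : ℝ := β * v + α - (⌈β * v + α⌉ - 1)

/-- Digits for the left-continuous version. -/
def OmG (α β : ℝ) (v : ℝ) : ℕ → ℕ := fun n => (⌈β * ((G α β)^[n] v) + α⌉ - 1).toNat

lemma G_mem (α β v : ℝ) : 0 < G α β v ∧ G α β v ≤ 1 := by
  unfold G
  have h1 := Int.ceil_lt_add_one (β * v + α)
  have h2 := Int.le_ceil (β * v + α)
  constructor <;> linarith

lemma G_iter_mem (α β : ℝ) (n : ℕ) : 0 < (G α β)^[n] 1 ∧ (G α β)^[n] 1 ≤ 1 := by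
  cases n with
  | zero => simp
  | succ n => rw [Function.iterate_succ_apply']; exact G_mem _ _ _

lemma OmG_succ (α β s : ℝ) (n : ℕ) : OmG α β s (n + 1) = OmG α β (G α β s) n := by
  simp [OmG, Function.iterate_succ_apply]

lemma G_digit {α β g : ℝ} (hα0 : 0 ≤ α) (hβ : 2 < β) (h0 : 0 < g) :
    β * g + α = G α β g + (OmG α β g 0 : ℕ) := by
  have hn : 0 ≤ ⌈β * g + α⌉ - 1 := by
    have : 0 < ⌈β * g + α⌉ := Int.ceil_pos.2 (by nlinarith)
    omega
  have : (((⌈β * g + α⌉ - 1).toNat : ℕ) : ℝ) = ((⌈β * g + α⌉ - 1 : ℤ) : ℝ) := by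
    have := Int.toNat_of_nonneg hn
    exact_mod_cast congrArg (Int.cast : ℤ → ℝ) this
  have h2 : ((OmG α β g 0 : ℕ) : ℝ) = ((⌈β * g + α⌉ - 1 : ℤ) : ℝ) := this
  rw [h2, G]
  push_cast
  ring

lemma G_digit_of {α β g : ℝ} {e : ℕ} {r : ℝ} (h : β * g + α = r + e) (h0 : 0 < r) (h1 : r ≤ 1) :
    OmG α β g 0 = e ∧ G α β g = r := by
  have hf : ⌈β * g + α⌉ = (e : ℤ) + 1 := by
    rw [Int.ceil_eq_iff, h]
    push_cast
    constructor <;> linarith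
  refine ⟨?_, ?_⟩
  · simp only [OmG, Function.iterate_zero, id]
    rw [hf]; simp
  · rw [G, hf, h]; push_cast; ring

lemma near_left {α β : ℝ} (hα0 : 0 ≤ α) (hβ : 2 < β) (n : ℕ) :
    ∀ g : ℝ, 0 < g → g ≤ 1 → ∃ ε > 0, ∀ t : ℝ, 0 ≤ t → g - ε < t → t < g →
      ∀ i < n, Om α β t i = OmG α β g i := by
  have hb0 : 0 < β := by linarith
  induction n with
  | zero => intro g _ _; exact ⟨1, one_pos, fun _ _ _ _ i hi => by omega⟩
  | succ n ih =>
    intro g hg0 hg1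
    obtain ⟨hG0, hG1⟩ := G_mem α β g
    obtain ⟨ε, hε, h⟩ := ih (G α β g) hG0 hG1
    refine ⟨min ε (G α β g) / β, by positivity, fun t ht0 ht1 ht2 i hi => ?_⟩
    have hdig := G_digit hα0 hβ hg0
    have h1 : β * t < β * g := by nlinarith
    have h2 : β * g - min ε (G α β g) < β * t := by
      have : β * (g - min ε (G α β g) / β) < β * t := by nlinarith
      have e1 : β * (g - min ε (G α β g) / β) = β * g - min ε (G α β g) := by field_simp
      linarith
    have h3 := min_le_left ε (G α β g)
    have h4 := min_le_right ε (G α β g)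
    obtain ⟨hd1, hd2⟩ := digit_of (α := α) (β := β) (s := t) (e := OmG α β g 0)
      (r := β * t + α - (OmG α β g 0 : ℕ)) (by ring) (by linarith) (by linarith)
    cases i with
    | zero => exact hd1
    | succ i =>
      rw [Om_succ, OmG_succ]
      apply h _ (F_mem _ _ _).1 _ _ i (by omega)
      · rw [hd2]; linarith
      · rw [hd2]; linarith

/-! ### Monotonicity of the coding -/

lemma Om_mono {α β : ℝ} (hα0 : 0 ≤ α) (hβ : 2 < β) {t s : ℝ} (ht0 : 0 ≤ t) (ht1 : t < 1)
    (hs1 : s < 1) (hts : t ≤ s) : lexLe (Om α β t) (Om α β s) := by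
  classical
  by_cases h : Om α β t = Om α β s
  · exact Or.inl h
  right
  have hex : ∃ k, Om α β t k ≠ Om α β s k := by
    by_contra hc
    push Not at hc
    exact h (funext hc)
  have hlt : ∀ i < Nat.find hex, Om α β t i = Om α β s i := by
    intro i hi
    have := Nat.find_min hex hi
    push Not at this
    exact this
  have hle : ∀ i ≤ Nat.find hex, (F α β)^[i] t ≤ (F α β)^[i] s := by
    intro i
    induction i with
    | zero => intro _; exact hts
    | succ i ih =>
      intro hi
      have h1 := ih (by omega)
      have h2 := hlt i (by omega)
      rw [Function.iterate_succ_apply', Function.iterate_succ_apply',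
        F_digit hα0 hβ (F_iter_mem α β t ht0 ht1 i).1,
        F_digit hα0 hβ (F_iter_mem α β s (ht0.trans hts) hs1 i).1, Om_iter, Om_iter,
        add_zero, h2]
      nlinarith
  refine ⟨Nat.find hex, hlt, lt_of_le_of_ne ?_ (Nat.find_spec hex)⟩
  simp only [Om]
  apply Int.toNat_le_toNat
  apply Int.floor_le_floor
  have h1 := hle _ le_rfl
  have h2 := mul_le_mul_of_nonneg_left h1 (show 0 ≤ β by linarith)
  exact add_le_add h2 le_rfl

lemma b_eq {α β : ℝ} (hα0 : 0 ≤ α) (hβ : 2 < β)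
    {b : ℕ → ℕ} (hb : b ∈ Sig α β) (hbsup : ∀ y ∈ Sig α β, lexLe y b) (n : ℕ) :
    b n = OmG α β 1 n := by
  obtain ⟨_, ⟨t, ⟨ht0, ht1⟩, rfl⟩, htb⟩ := exists_of_mem_closure hb (n + 1)
  obtain ⟨ε, hε, h⟩ := near_left hα0 hβ (n + 1) 1 one_pos le_rfl
  set s := max t (1 - ε / 2) with hs
  have hts : t ≤ s := le_max_left _ _
  have hs1 : s < 1 := max_lt ht1 (by linarith)
  have hse : 1 - ε < s := lt_of_lt_of_le (by linarith) (le_max_right _ _)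
  have hsSig : Om α β s ∈ Sig α β := subset_closure ⟨s, ⟨ht0.trans hts, hs1⟩, rfl⟩
  rw [← h s (ht0.trans hts) hse hs1 n (by omega)]
  have h1 := hbsup _ hsSig
  have h2 := Om_mono hα0 hβ ht0 ht1 hs1 hts
  rcases h1 with h1 | ⟨k, hk1, hk2⟩
  · rw [h1]
  by_cases hkn : n < k
  · exact (hk1 n hkn).symm
  exfalso
  have hkb := htb k (by omega)
  rcases h2 with h2 | ⟨k', hk1', hk2'⟩
  · rw [h2] at hkb; omega
  · rcases lt_trichotomy k' k with h3 | h3 | h3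
    · have e1 := hk1 k' h3
      have e2 := htb k' (by omega)
      omega
    · subst h3; omega
    · have := hk1' k h3
      omega

/-! ### Long images of cylinders along the point -/

lemma pre_succ (y : ℕ → ℕ) (n : ℕ) : pre y (n + 1) = pre y n ++ [y n] := by
  rw [pre, List.ofFn_succ_last]
  simp [pre]

lemma pre_length (y : ℕ → ℕ) (n : ℕ) : (pre y n).length = n := by simp [pre]

lemma exists_lower (α β : ℝ) (M : ℕ) : ∃ δ > 0, ∀ j ≤ M, δ ≤ (G α β)^[j] 1 := by
  induction M with
  | zero => exact ⟨1, one_pos, fun j hj => by simp [Nat.le_zero.1 hj]⟩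
  | succ M ih =>
    obtain ⟨δ, hδ, h⟩ := ih
    refine ⟨min δ ((G α β)^[M + 1] 1), lt_min hδ (G_iter_mem α β _).1, fun j hj => ?_⟩
    rcases Nat.lt_or_ge j (M + 1) with h1 | h1
    · exact (min_le_left _ _).trans (h j (by omega))
    · have : j = M + 1 := by omega
      subst this
      exact min_le_right _ _

lemma long_image {α β : ℝ} (hα0 : 0 ≤ α) (hβ : 2 < β)
    {b : ℕ → ℕ} (hbG : ∀ n, b n = OmG α β 1 n)
    {x : ℕ → ℕ} (hx : x ∈ Sig α β) {M : ℕ}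
    (hxb : ∀ n j, (∀ i < n, x (j + i) = b i) → n ≤ M)
    {η : ℝ} (hη1 : ∀ i, (F α β)^[i] 0 ≤ 1 - η) (hη0 : 0 < η)
    (hη2 : ∀ j ≤ M, η ≤ (G α β)^[j] 1) (n : ℕ) :
    ∃ u v : ℝ, ∃ i q j : ℕ, u = (F α β)^[i] 0 ∧ v = (G α β)^[j] 1 ∧ q + j = n ∧
      (∀ m < j, x (q + m) = b m) ∧ η ≤ v - u ∧
      (∀ t, u ≤ t → t < v → valid α β (pre x n) t) ∧
      (∀ s, 0 ≤ s → s < 1 → (∀ m < n, Om α β s m = x m) →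
        u ≤ (F α β)^[n] s ∧ (F α β)^[n] s < v) := by
  have hb0 : 0 < β := by linarith
  induction n with
  | zero =>
    refine ⟨0, 1, 0, 0, 0, rfl, rfl, rfl, fun m hm => by omega, ?_, ?_, ?_⟩
    · have := hη1 0
      simp at this
      linarith
    · intro t h0 h1; exact ⟨h0, h1⟩
    · intro s h0 h1 _; exact ⟨h0, h1⟩
  | succ n ih =>
    obtain ⟨u, v, i, q, j, hu, hv, hqj, hdig, hlen, hval, htight⟩ := ih
    have hu0 : 0 ≤ u := by rw [hu]; exact (F_iter_mem α β 0 le_rfl one_pos i).1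
    have hv1 : v ≤ 1 := by rw [hv]; exact (G_iter_mem α β j).2
    have hv0 : 0 < v := by rw [hv]; exact (G_iter_mem α β j).1
    set e := x n with he
    -- tightness for the new endpoints
    have htight' : ∀ s, 0 ≤ s → s < 1 → (∀ m < n + 1, Om α β s m = x m) →
        max (β * u + α - e) 0 ≤ (F α β)^[n + 1] s ∧
          (F α β)^[n + 1] s < min (β * v + α - e) 1 := by
      intro s hs0 hs1 hs
      obtain ⟨h1, h2⟩ := htight s hs0 hs1 (fun m hm => hs m (by omega))
      have h3 := F_iter_mem α β s hs0 hs1 (n + 1)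
      have h4 : (F α β)^[n + 1] s = β * (F α β)^[n] s + α - e := by
        rw [Function.iterate_succ_apply', F_digit hα0 hβ (F_iter_mem α β s hs0 hs1 n).1,
          Om_iter, add_zero, hs n (by omega)]
      refine ⟨max_le ?_ h3.1, lt_min ?_ h3.2⟩
      · rw [h4]; nlinarith
      · rw [h4]; nlinarith
    have hval' : ∀ t, max (β * u + α - e) 0 ≤ t → t < min (β * v + α - e) 1 →
        valid α β (pre x (n + 1)) t := by
      intro t h1 h2
      rw [pre_succ, valid_append]
      have h3 := (le_max_left _ _).trans h1
      have h4 := (le_max_right _ _).trans h1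
      have h5 := h2.trans_le (min_le_left _ _)
      have h6 := h2.trans_le (min_le_right _ _)
      have h7 : u ≤ (t + e - α) / β := by rw [le_div_iff₀ hb0]; linarith
      have h8 : (t + e - α) / β < v := by rw [div_lt_iff₀ hb0]; linarith
      exact ⟨hval _ h7 h8, ⟨⟨hu0.trans h7, h8.trans_le hv1⟩, ⟨h4, h6⟩⟩⟩
    obtain ⟨_, ⟨s, ⟨hs0, hs1⟩, rfl⟩, hs⟩ := exists_of_mem_closure hx (n + 1)
    obtain ⟨hr1, hr2⟩ := htight' s hs0 hs1 hs
    have hlt := hr1.trans_lt hr2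
    have hlen2 : η ≤ β * v - β * u := by nlinarith
    -- the left endpoint
    have hU : ∃ i', max (β * u + α - e) 0 = (F α β)^[i'] 0 ∧
        (i' = 0 ∨ max (β * u + α - e) 0 = β * u + α - e) := by
      rcases le_total 0 (β * u + α - e) with h | h
      · refine ⟨i + 1, ?_, Or.inr (max_eq_left h)⟩
        rw [max_eq_left h] at hlt ⊢
        rw [Function.iterate_succ_apply', ← hu]
        exact (digit_of (e := e) (by ring) h (hlt.trans_le (min_le_right _ _))).2.symm
      · exact ⟨0, by simp [h], Or.inl rfl⟩
    have hV : ∃ q' j', min (β * v + α - e) 1 = (G α β)^[j'] 1 ∧ q' + j' = n + 1 ∧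
        (∀ m < j', x (q' + m) = b m) ∧
        (j' = 0 ∨ min (β * v + α - e) 1 = β * v + α - e) := by
      rcases le_total (β * v + α - e) 1 with h | h
      · rw [min_eq_left h] at hlt ⊢
        have hpos : 0 < β * v + α - e := (le_max_right _ _).trans_lt hlt
        obtain ⟨d1, d2⟩ := G_digit_of (α := α) (β := β) (g := v) (e := e) (by ring) hpos h
        refine ⟨q, j + 1, ?_, by omega, ?_, Or.inr rfl⟩
        · rw [Function.iterate_succ_apply', ← hv, d2]
        · intro m hm
          rcases Nat.lt_or_ge m j with h1 | h1
          · exact hdig m h1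
          · have : m = j := by omega
            subst this
            rw [hqj, hbG, ← he, ← d1, hv]
            simp [OmG]
      · exact ⟨n + 1, 0, by simp [h], rfl, fun m hm => by omega, Or.inl rfl⟩
    obtain ⟨i', hU1, hU2⟩ := hU
    obtain ⟨q', j', hV1, hV2, hV3, hV4⟩ := hV
    refine ⟨_, _, i', q', j', hU1, hV1, hV2, hV3, ?_, hval', htight'⟩
    rcases hV4 with h | h
    · rw [hV1, h, hU1]
      have := hη1 i'
      simp only [Function.iterate_zero, id]
      linarith
    · rcases hU2 with h' | h'
      · rw [hU1, h', hV1]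
        have := hη2 j' (hxb _ _ hV3)
        simp only [Function.iterate_zero, id]
        linarith
      · rw [h, h']; linarith

/-! ### The symbolic construction -/

/-- `u` extends to a free word by a word of length `τ`. -/
def Ext (α β : ℝ) (τ : ℕ) (u : List ℕ) : Prop := ∃ v : List ℕ, v.length = τ ∧ free α β (u ++ v)

/-- All prefixes are extendable. -/
def Good (α β : ℝ) (τ : ℕ) (u : List ℕ) : Prop := ∀ u', u' <+: u → Ext α β τ u'

/-- The subshift. -/
def Sub (α β : ℝ) (τ : ℕ) : Set (ℕ → ℕ) := {y | ∀ n, Ext α β τ (pre y n)}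

lemma pre_congr {y z : ℕ → ℕ} {n : ℕ} (h : ∀ i < n, y i = z i) : pre y n = pre z n := by
  apply List.ext_getElem (by simp [pre])
  intro i h1 h2
  simp only [pre, List.getElem_ofFn]
  exact h i (by simpa [pre] using h1)

lemma pre_eq_of {y : ℕ → ℕ} {w : List ℕ} (h : ∀ i (hi : i < w.length), y i = w[i]) :
    pre y w.length = w := by
  apply List.ext_getElem (by simp [pre])
  intro i h1 h2
  simp only [pre, List.getElem_ofFn]
  exact h i h2

lemma Ext_of_append {α β : ℝ} (hα0 : 0 ≤ α) (hα1 : α < 1) (hβ : 2 < β) {τ : ℕ} {u v : List ℕ}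
    (h : free α β (u ++ v)) (hv : v.length ≤ τ) : Ext α β τ u := by
  refine ⟨v ++ List.replicate (τ - v.length) 1, by simp; omega, ?_⟩
  rw [← List.append_assoc]
  exact free_append h (free_ones hα0 hα1 hβ _)

lemma prefix_append_cases {u' u v : List ℕ} (h : u' <+: u ++ v) :
    u' <+: u ∨ ∃ v', v' <+: v ∧ u' = u ++ v' := by
  rcases List.prefix_or_prefix_of_prefix h (List.prefix_append u v) with h1 | h1
  · exact Or.inl h1
  · right
    obtain ⟨v', rfl⟩ := h1
    exact ⟨v', (List.prefix_append_right_inj u).1 h, rfl⟩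

lemma Good_append_free {α β : ℝ} {τ : ℕ} {f u : List ℕ}
    (hf : free α β f) (hG : Good α β τ f) (hu : Good α β τ u) : Good α β τ (f ++ u) := by
  intro u' h
  rcases prefix_append_cases h with h1 | ⟨v', h1, rfl⟩
  · exact hG _ h1
  · obtain ⟨v, hv, hv'⟩ := hu v' h1
    exact ⟨v, hv, by rw [List.append_assoc]; exact free_append hf hv'⟩

lemma Good_connector {α β : ℝ} (hα0 : 0 ≤ α) (hα1 : α < 1) (hβ : 2 < β) {τ : ℕ} {u v : List ℕ}
    (hu : Good α β τ u) (h : free α β (u ++ v)) (hv : v.length ≤ τ) : Good α β τ (u ++ v) := by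
  intro u' hu'
  rcases prefix_append_cases hu' with h1 | ⟨v', ⟨r, rfl⟩, rfl⟩
  · exact hu _ h1
  · apply Ext_of_append hα0 hα1 hβ (v := r)
    · rwa [List.append_assoc]
    · simp at hv; omega

lemma Good_nil {α β : ℝ} (hα0 : 0 ≤ α) (hα1 : α < 1) (hβ : 2 < β) (τ : ℕ) : Good α β τ [] := by
  intro u' h
  rw [List.prefix_nil.1 h]
  exact Ext_of_append hα0 hα1 hβ (v := []) (free_nil α β) (by simp)

lemma lang_iff {α β : ℝ} (hα0 : 0 ≤ α) (hα1 : α < 1) (hβ : 2 < β) (τ : ℕ) (w : List ℕ) :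
    langOf (Sub α β τ) w ↔ Good α β τ w := by
  constructor
  · rintro ⟨y, hy, h⟩ u' ⟨r, rfl⟩
    have : pre y u'.length = u' := by
      apply pre_eq_of
      intro i hi
      have := h ⟨i, by simp; omega⟩
      simp only [List.get_eq_getElem] at this
      rw [this, List.getElem_append_left hi]
    rw [← this]
    exact hy _
  · intro h
    obtain ⟨v, hv, hf⟩ := h w List.prefix_rfl
    have hG := Good_connector hα0 hα1 hβ h hf hv.le
    have hones : ∀ m, Good α β τ (List.replicate m 1) := by
      intro m u' hu'
      obtain ⟨r, hr⟩ := hu'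
      refine ⟨List.replicate τ 1, by simp, ?_⟩
      have : u' = List.replicate u'.length 1 := by
        rw [List.eq_replicate_iff]
        refine ⟨rfl, fun a ha => ?_⟩
        have : a ∈ List.replicate m 1 := by rw [← hr]; simp [ha]
        exact (List.mem_replicate.1 this).2
      rw [this]
      exact free_append (free_ones hα0 hα1 hβ _) (free_ones hα0 hα1 hβ _)
    refine ⟨fun n => (w ++ v).getD n 1, ?_, ?_⟩
    · intro n
      apply Good_append_free hf hG (hones n)
      refine ⟨(((w ++ v) ++ List.replicate n 1).drop n), ?_⟩
      conv_rhs => rw [← List.take_append_drop n ((w ++ v) ++ List.replicate n 1)]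
      congr 1
      apply List.ext_getElem
      · simp [pre]
        omega
      · intro i h1 h2
        have hi : i < n := by simpa [pre] using h1
        simp only [pre, List.getElem_ofFn, List.getElem_take, List.getD_eq_getElem?_getD]
        rcases Nat.lt_or_ge i (w ++ v).length with h3 | h3
        · rw [List.getElem_append_left h3, List.getElem?_eq_getElem h3]; rfl
        · rw [List.getElem_append_right h3, List.getElem?_eq_none h3]; simp
    · intro i
      have h3 : (i : ℕ) < (w ++ v).length := by simp; omega
      simp only [List.getD_eq_getElem?_getD, List.get_eq_getElem]
      rw [List.getElem?_eq_getElem h3, List.getElem_append_left i.2]; rfl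

lemma hasSpec_Sub {α β : ℝ} (hα0 : 0 ≤ α) (hα1 : α < 1) (hβ : 2 < β) (τ : ℕ) (hτ : 1 ≤ τ) :
    HasSpec (langOf (Sub α β τ)) (langOf (Sub α β τ)) := by
  refine ⟨τ, hτ, fun n w hw => ?_⟩
  simp only [lang_iff hα0 hα1 hβ] at hw ⊢
  choose v hv hf using fun i => hw i (w i) List.prefix_rfl
  refine ⟨fun i => v i.castSucc, fun i => ⟨hv _, ?_⟩, ?_⟩
  · have := Good_connector hα0 hα1 hβ (u := []) (Good_nil hα0 hα1 hβ τ)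
      (by simpa using free_suffix (hf i.castSucc)) (hv i.castSucc).le
    simpa using this
  · have key : ∀ L : List (List ℕ), (∀ f ∈ L, free α β f ∧ Good α β τ f) →
        free α β L.flatten ∧ Good α β τ L.flatten := by
      intro L
      induction L with
      | nil => intro _; exact ⟨free_nil α β, Good_nil hα0 hα1 hβ τ⟩
      | cons f L ih =>
        intro h
        have h1 := h f (by simp)
        have h2 := ih (fun g hg => h g (by simp [hg]))
        rw [List.flatten_cons]
        exact ⟨free_append h1.1 h2.1, Good_append_free h1.1 h1.2 h2.2⟩
    have hL := key (List.ofFn fun i : Fin n => w i.castSucc ++ v i.castSucc) (by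
      intro f hfm
      obtain ⟨i, rfl⟩ := (List.mem_ofFn' _ _).1 hfm
      exact ⟨hf _, Good_connector hα0 hα1 hβ (hw _) (hf _) (hv _).le⟩)
    exact Good_append_free hL.1 hL.2 (hw _)


/-- **Corollary.** For `0 ≤ α < 1` and `β > 2` with `𝖣(a)` bounded: if `x ∈ Σ`
does not contain arbitrarily long initial subwords of `b`, then `x` belongs to a
closed shift-invariant subset `Σ' ⊆ Σ` whose language has specification. -/
theorem mem_subshift_with_spec (α β : ℝ) (hα0 : 0 ≤ α) (hα1 : α < 1) (hβ : 2 < β)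
    (b : ℕ → ℕ) (hb : b ∈ Sig α β) (hbsup : ∀ y ∈ Sig α β, lexLe y b)
    (hD : BddAbove (D (Om α β 0) b))
    (x : ℕ → ℕ) (hx : x ∈ Sig α β)
    (hxb : BddAbove {n : ℕ | ∃ j, ∀ i < n, x (j + i) = b i}) :
    ∃ S' : Set (ℕ → ℕ), S' ⊆ Sig α β ∧ IsClosed S' ∧ (∀ y ∈ S', shift y ∈ S') ∧
      x ∈ S' ∧ HasSpec (langOf S') (langOf S') := by
  have hb0 : 0 < β := by linarith
  have hbG := b_eq hα0 hβ hb hbsup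
  obtain ⟨Ma, hMa⟩ := hD
  obtain ⟨M, hM⟩ := hxb
  obtain ⟨ε, hε, hnear⟩ := near_left hα0 hβ (Ma + 1) 1 one_pos le_rfl
  obtain ⟨δ, hδ, hδ'⟩ := exists_lower α β M
  have hF : ∀ i, (F α β)^[i] 0 ≤ 1 - ε := by
    intro i
    by_contra hc
    push Not at hc
    have hm := F_iter_mem α β 0 le_rfl one_pos i
    have h1 := hnear _ hm.1 hc hm.2
    have : Ma + 1 ∈ D (Om α β 0) b := ⟨i, fun k hk => by
      rw [← Om_iter, h1 k hk, hbG]⟩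
    have := hMa this
    omega
  have hη0 : 0 < min ε δ := lt_min hε hδ
  obtain ⟨N, hN⟩ := pow_unbounded_of_one_lt (1 / min ε δ) (show 1 < β / 2 by linarith)
  have hN' : 1 < (β / 2) ^ (N + 1) * min ε δ := by
    rw [div_lt_iff₀ hη0] at hN
    rw [pow_succ]
    nlinarith
  refine ⟨Sub α β (N + 1), ?_, ?_, ?_, ?_, hasSpec_Sub hα0 hα1 hβ (N + 1) (by omega)⟩
  · intro y hy
    apply mem_closure_of_exists
    intro n
    obtain ⟨v, _, hv⟩ := hy n
    have hv0 := hv 0 le_rfl one_pos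
    have hp := valid_pull hv0
    refine ⟨_, ⟨_, ⟨hp.1, hp.2⟩, rfl⟩, fun i hi => ?_⟩
    have hi' : i < (pre y n).length := by rwa [pre_length]
    rw [Om_pull hβ hv0 i (by simp only [List.length_append]; omega),
      List.getElem_append_left hi']
    simp [pre]
  · apply isClosed_of_closure_subset
    intro y hy n
    obtain ⟨z, hz, hzy⟩ := exists_of_mem_closure hy n
    rw [← pre_congr hzy]
    exact hz n
  · intro y hy n
    obtain ⟨v, hv, hf⟩ := hy (n + 1)
    refine ⟨v, hv, ?_⟩
    have : pre y (n + 1) = [y 0] ++ pre (shift y) n := by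
      simp [pre, shift, List.ofFn_succ]
    rw [this, List.append_assoc] at hf
    exact free_suffix hf
  · intro n
    obtain ⟨u, v, i, q, j, hu, hv, -, -, hlen, hval, -⟩ :=
      long_image hα0 hβ hbG hx (M := M) (fun n j h => hM ⟨j, h⟩)
        (η := min ε δ) (fun i => (hF i).trans (by linarith [min_le_left ε δ])) hη0
        (fun j hj => (min_le_right _ _).trans (hδ' j hj)) n
    have hu0 : 0 ≤ u := by rw [hu]; exact (F_iter_mem α β 0 le_rfl one_pos i).1
    have hv1 : v ≤ 1 := by rw [hv]; exact (G_iter_mem α β j).2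
    have hpos : 0 < (β / 2) ^ (N + 1) := by positivity
    obtain ⟨w, hw, hw'⟩ := growth hα0 hα1 hβ (N + 1) u v hu0 hv1 (by linarith)
      (hN'.trans_le (mul_le_mul_of_nonneg_left hlen hpos.le))
    refine ⟨w, hw, fun t h0 h1 => ?_⟩
    obtain ⟨a1, a2, a3⟩ := hw' t h0 h1
    exact (valid_append _ _ _ _ _).2 ⟨hval _ a2 a3, a1⟩

end IntermediateBeta
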